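/- arXiv:2302.09666 — 5 statements merged into one kernel-verified Lean document; each statement's English description precedes it below -/
import Mathlib

section
/- If two canonical command sequences contain exactly the same set of commands, then they are semantically equivalent. -/
namespace FileSync

/-- A filesystem value: a directory, the empty value, or a file with content from `C`. -/
inductive Val (C : Type) : Type where
  | dir : Val C
  | empty : Val C
  | file : C → Val C

/-- The type of a value, ordered E < F < D via 0 < 1 < 2. -/
def vtype {C : Type} : Val C → ℕ
  | Val.empty => 0
  | Val.file _ => 1
  | Val.dir => 2

/-- A node is a nonempty finite sequence of names. -/
abbrev Node (N : Type) : Type := { l : List N // l ≠ ([] : List N) }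

/-- `Anc m n`: `m` is a proper ancestor of (strictly above) `n`. -/
def Anc {N : Type} (m n : Node N) : Prop := m.1 <+: n.1 ∧ m ≠ n

/-- Two nodes are comparable if one is a prefix of the other. -/
def NodesComparable {N : Type} (m n : Node N) : Prop := m.1 <+: n.1 ∨ n.1 <+: m.1

/-- `IsParent p n`: `p` is the parent of `n` (removing the last name of `n` gives `p`). -/
def IsParent {N : Type} (p n : Node N) : Prop := ∃ a : N, n.1 = p.1 ++ [a]

/-- A command: a node, an input value (precondition) and an output value. -/
structure Cmd (N C : Type) where
  node : Node N
  inp : Val C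
  out : Val C

variable {N C : Type} [DecidableEq N]

/-- A valid filesystem: finitely many non-empty nodes, and the tree property. -/
def ValidFS (f : Node N → Val C) : Prop :=
  {n : Node N | f n ≠ Val.empty}.Finite ∧
  ∀ n m : Node N, Anc m n → f n ≠ Val.empty → f m = Val.dir

/-- Replace the value at the node of `σ` by its output value. -/
def upd (f : Node N → Val C) (σ : Cmd N C) : Node N → Val C :=
  fun m => if m = σ.node then σ.out else f m

/-- `SeqOK α f`: the command sequence `α` does not break the filesystem `f`:
each command finds its input value and yields a valid filesystem. -/
def SeqOK : List (Cmd N C) → (Node N → Val C) → Prop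
  | [], _ => True
  | σ :: rest, f => f σ.node = σ.inp ∧ ValidFS (upd f σ) ∧ SeqOK rest (upd f σ)

/-- The result of applying a command sequence (left to right). -/
def applySeq : List (Cmd N C) → (Node N → Val C) → (Node N → Val C)
  | [], f => f
  | σ :: rest, f => applySeq rest (upd f σ)

/-- A sequence is non-breaking if there is at least one filesystem it does not break. -/
def NonBreaking (α : List (Cmd N C)) : Prop := ∃ f, ValidFS f ∧ SeqOK α f

/-- Semantic equivalence: on every filesystem both break, or both yield the same result. -/
def SeqEquiv (α β : List (Cmd N C)) : Prop :=
  ∀ f, ValidFS f → ((SeqOK α f ↔ SeqOK β f) ∧ (SeqOK α f → applySeq α f = applySeq β f))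

/-- `SeqExt α β`: `β` semantically extends `α` (`α ≤ β`). -/
def SeqExt (α β : List (Cmd N C)) : Prop :=
  ∀ f, ValidFS f → SeqOK α f → SeqOK β f ∧ applySeq β f = applySeq α f

/-- The `≪` relation between commands on child–parent or parent–child nodes. -/
def LL (σ τ : Cmd N C) : Prop :=
  (IsParent τ.node σ.node ∧ σ.out = Val.empty ∧ σ.inp ≠ Val.empty ∧
      τ.inp = Val.dir ∧ τ.out ≠ Val.dir) ∨
  (IsParent σ.node τ.node ∧ σ.out = Val.dir ∧ σ.inp ≠ Val.dir ∧
      τ.inp = Val.empty ∧ τ.out ≠ Val.empty)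

/-- A canonical command set: finite, no null commands, at most one command per node,
`≪`-connected (commands on distinct comparable nodes are joined by a `≪`-chain in the set). -/
def Canonical (A : Set (Cmd N C)) : Prop :=
  A.Finite ∧
  (∀ σ ∈ A, σ.inp ≠ σ.out) ∧
  (∀ σ ∈ A, ∀ τ ∈ A, σ.node = τ.node → σ = τ) ∧
  (∀ σ ∈ A, ∀ τ ∈ A, σ.node ≠ τ.node → NodesComparable σ.node τ.node →
    Relation.ReflTransGen (fun a b => a ∈ A ∧ b ∈ A ∧ LL a b) σ τ ∨
    Relation.ReflTransGen (fun a b => a ∈ A ∧ b ∈ A ∧ LL a b) τ σ)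

/-- A sequence honors `≪`: whenever `σ ≪ τ` for members, `σ` precedes `τ`. -/
def Honors (α : List (Cmd N C)) : Prop :=
  ∀ σ ∈ α, ∀ τ ∈ α, LL σ τ → List.Sublist [σ, τ] α

/-- A canonical sequence: its commands form a canonical set and it honors `≪`. -/
def CanonicalSeq (α : List (Cmd N C)) : Prop :=
  α.Nodup ∧ Canonical {σ : Cmd N C | σ ∈ α} ∧ Honors α

/-- `Orders A α`: the sequence `α` is an arrangement of the set `A` honoring `≪`. -/
def Orders (A : Set (Cmd N C)) (α : List (Cmd N C)) : Prop :=
  α.Nodup ∧ (∀ σ : Cmd N C, σ ∈ α ↔ σ ∈ A) ∧ Honors α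

/-- The action of a canonical set: `A` does not break `f`
(some `≪`-honoring arrangement exists, and every such arrangement works on `f`). -/
def SetNoBreak (A : Set (Cmd N C)) (f : Node N → Val C) : Prop :=
  (∃ α, Orders A α) ∧ ∀ α, Orders A α → SeqOK α f

/-- `SetApp A f g`: applying the set `A` (in any `≪`-honoring order) to `f` yields `g`. -/
def SetApp (A : Set (Cmd N C)) (f g : Node N → Val C) : Prop :=
  SetNoBreak A f ∧ ∀ α, Orders A α → applySeq α f = g

/-- The set `S` has a command on node `n`. -/
def Mentions (S : Set (Cmd N C)) (n : Node N) : Prop := ∃ ρ ∈ S, ρ.node = n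

/-- Two canonical sets are refluent if some filesystem is broken by neither. -/
def Refluent (A B : Set (Cmd N C)) : Prop :=
  ∃ f, ValidFS f ∧ SetNoBreak A f ∧ SetNoBreak B f

/-- Canonical sets are jointly refluent if a single filesystem is broken by none of them. -/
def JointlyRefluent {k : ℕ} (A : Fin k → Set (Cmd N C)) : Prop :=
  ∃ f, ValidFS f ∧ ∀ i, SetNoBreak (A i) f

/-- Two distinct commands are in conflict if they are on the same node, or one is on a
proper ancestor node, creates a non-directory, and the lower one creates non-empty content. -/
def Conflict (σ τ : Cmd N C) : Prop :=
  σ ≠ τ ∧ (σ.node = τ.node ∨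
    (Anc σ.node τ.node ∧ σ.out ≠ Val.dir ∧ τ.out ≠ Val.empty) ∨
    (Anc τ.node σ.node ∧ τ.out ≠ Val.dir ∧ σ.out ≠ Val.empty))

/-- A merger: a maximal canonical subset of `⋃ i, A i`. -/
def Merger {k : ℕ} (A : Fin k → Set (Cmd N C)) (M : Set (Cmd N C)) : Prop :=
  M ⊆ (⋃ i, A i) ∧ Canonical M ∧
  ∀ M' : Set (Cmd N C), M ⊆ M' → M' ⊆ (⋃ i, A i) → Canonical M' → M' = M

/-- `B` is an initial segment of `A`: there is an `≪`-honoring arrangement of `A` in which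
all commands of `B` precede all commands of `A \ B`. -/
def InitSeg (B A : Set (Cmd N C)) : Prop :=
  B ⊆ A ∧ ∃ α₁ α₂ : List (Cmd N C), Orders B α₁ ∧ Orders (A \ B) α₂ ∧ Orders A (α₁ ++ α₂)

/-- The inverse of a command. -/
def cinv (σ : Cmd N C) : Cmd N C := ⟨σ.node, σ.out, σ.inp⟩

/-- The inverse of a sequence: inverses of its commands in reverse order. -/
def seqInv (α : List (Cmd N C)) : List (Cmd N C) := (α.map cinv).reverse

theorem before_trans {γ : Type} {a b c : γ} : ∀ {l : List γ}, l.Nodup →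
    List.Sublist [a, b] l → List.Sublist [b, c] l → List.Sublist [a, c] l
  | [], _, h, _ => by simp at h
  | x :: l, hn, h1, h2 => by
    rw [List.nodup_cons] at hn
    rw [List.sublist_cons_iff] at h1 h2 ⊢
    rcases h1 with h1 | ⟨r, hr, h1⟩
    · rcases h2 with h2 | ⟨r, hr, h2⟩
      · exact Or.inl (before_trans hn.2 h1 h2)
      · simp only [List.cons.injEq] at hr
        obtain ⟨rfl, rfl⟩ := hr
        exact absurd (h1.subset (by simp)) hn.1
    · simp only [List.cons.injEq] at hr
      obtain ⟨rfl, rfl⟩ := hr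
      right
      refine ⟨[c], rfl, ?_⟩
      rcases h2 with h2 | ⟨r, hr, h2⟩
      · exact List.singleton_sublist.2 (h2.subset (by simp))
      · simp only [List.cons.injEq] at hr
        obtain ⟨rfl, rfl⟩ := hr
        exact h2

theorem before_asymm {γ : Type} {a b : γ} {l : List γ} (hn : l.Nodup)
    (h1 : List.Sublist [a, b] l) (h2 : List.Sublist [b, a] l) : False := by
  have := (before_trans hn h1 h2).nodup hn
  simp at this

theorem upd_comm (f : Node N → Val C) (σ τ : Cmd N C) (h : σ.node ≠ τ.node) :
    upd (upd f τ) σ = upd (upd f σ) τ := by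
  funext m
  unfold upd
  by_cases h1 : m = σ.node
  · have : m ≠ τ.node := fun h2 => h (h1.symm.trans h2)
    simp [h1, h]
  · simp [h1]

theorem valid_swap {f : Node N → Val C} {σ τ : Cmd N C}
    (hc : ¬ NodesComparable σ.node τ.node) (hf : ValidFS f)
    (h : ValidFS (upd (upd f τ) σ)) : ValidFS (upd f σ) := by
  constructor
  · refine (hf.1.union (Set.finite_singleton σ.node)).subset ?_
    intro n hn
    by_cases h1 : n = σ.node
    · exact Or.inr h1
    · left
      simpa [upd, h1] using hn
  · intro n m ha hn
    have h0 := hf.2 n m ha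
    have h2 := h.2 n m ha
    have hp := ha.1
    by_cases hσ : n = σ.node
    · have hm : m ≠ τ.node := by
        rintro rfl
        exact hc (Or.inr (hσ ▸ hp))
      have hm' : m ≠ σ.node := fun h => ha.2 (h.trans hσ.symm)
      simp only [upd, hσ, hm, hm', if_true, if_false] at h2 hn ⊢
      exact h2 hn
    · by_cases hm : m = σ.node
      · have hn' : n ≠ τ.node := by
          rintro rfl
          exact hc (Or.inl (hm ▸ hp))
        simp only [upd, hσ, hm, hn', if_true, if_false] at h2 hn ⊢
        exact h2 hn
      · simp only [upd, hσ, hm, if_false] at hn ⊢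
        exact h0 hn

theorem swap_ok {f : Node N → Val C} {σ τ : Cmd N C} {l : List (Cmd N C)}
    (hc : ¬ NodesComparable σ.node τ.node) (hf : ValidFS f)
    (h : SeqOK (τ :: σ :: l) f) : SeqOK (σ :: τ :: l) f := by
  have hne : σ.node ≠ τ.node := fun h => hc (Or.inl (h ▸ List.prefix_rfl))
  obtain ⟨h1, h2, h3, h4, h5⟩ := h
  refine ⟨?_, valid_swap hc hf h4, ?_, ?_, ?_⟩
  · simpa [upd, hne] using h3
  · simpa [upd, hne.symm] using h1
  · rwa [← upd_comm f σ τ hne]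
  · rwa [← upd_comm f σ τ hne]

theorem equiv_cons {σ : Cmd N C} {α β : List (Cmd N C)} (h : SeqEquiv α β) :
    SeqEquiv (σ :: α) (σ :: β) := by
  intro f hf
  constructor
  · constructor
    · rintro ⟨h1, h2, h3⟩
      exact ⟨h1, h2, (h _ h2).1.1 h3⟩
    · rintro ⟨h1, h2, h3⟩
      exact ⟨h1, h2, (h _ h2).1.2 h3⟩
  · rintro ⟨h1, h2, h3⟩
    exact (h _ h2).2 h3

theorem equiv_trans {α β γ : List (Cmd N C)} (h : SeqEquiv α β) (h' : SeqEquiv β γ) :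
    SeqEquiv α γ := fun f hf =>
  ⟨(h f hf).1.trans (h' f hf).1,
   fun k => ((h f hf).2 k).trans ((h' f hf).2 ((h f hf).1.1 k))⟩

theorem equiv_swap {σ τ : Cmd N C} {l : List (Cmd N C)}
    (hc : ¬ NodesComparable σ.node τ.node) : SeqEquiv (σ :: τ :: l) (τ :: σ :: l) := by
  have hne : σ.node ≠ τ.node := fun h => hc (Or.inl (h ▸ List.prefix_rfl))
  intro f hf
  refine ⟨⟨swap_ok (fun h => hc h.symm) hf, swap_ok hc hf⟩, fun _ => ?_⟩
  simp only [applySeq]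
  rw [upd_comm f σ τ hne]

theorem equiv_move {σ : Cmd N C} {l₂ : List (Cmd N C)} : ∀ (l₁ : List (Cmd N C)),
    (∀ τ ∈ l₁, ¬ NodesComparable σ.node τ.node) →
    SeqEquiv (σ :: (l₁ ++ l₂)) (l₁ ++ σ :: l₂)
  | [], _ => fun _ _ => ⟨Iff.rfl, fun _ => rfl⟩
  | τ :: l₁, h => equiv_trans (equiv_swap (h τ (by simp)))
      (equiv_cons (equiv_move l₁ (fun ρ hρ => h ρ (by simp [hρ]))))

theorem equiv_of_order : ∀ (α β : List (Cmd N C)), α.Nodup → β.Nodup →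
    (∀ σ, σ ∈ α ↔ σ ∈ β) →
    (∀ σ τ, List.Sublist [σ, τ] α → NodesComparable σ.node τ.node →
      List.Sublist [σ, τ] β) → SeqEquiv α β
  | [], β, _, _, hs, _ => by
    have : β = [] := List.eq_nil_iff_forall_not_mem.2 (fun σ hσ => by simpa using (hs σ).2 hσ)
    subst this
    exact fun _ _ => ⟨Iff.rfl, fun _ => rfl⟩
  | σ :: α, β, hα, hβ, hs, ho => by
    classical
    obtain ⟨β₁, β₂, rfl⟩ := List.append_of_mem ((hs σ).1 (by simp))
    have hα' := List.nodup_cons.1 hα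
    have hβ' : σ ∉ β₁ ++ β₂ ∧ (β₁ ++ β₂).Nodup :=
      List.nodup_cons.1 (List.perm_middle.nodup_iff.1 hβ)
    have hs' : ∀ ρ, ρ ∈ α ↔ ρ ∈ β₁ ++ β₂ := by
      intro ρ
      have h := hs ρ
      by_cases hρ : ρ = σ
      · subst hρ
        exact iff_of_false hα'.1 hβ'.1
      · simpa [hρ] using h
    refine equiv_trans (equiv_cons (equiv_of_order α (β₁ ++ β₂) hα'.2 hβ'.2 hs' ?_))
      (equiv_move β₁ ?_)
    · intro a b hab hc
      have h1 := ho a b (hab.cons σ) hc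
      have ha : a ≠ σ := fun h => hα'.1 (h ▸ hab.subset (by simp))
      have hb : b ≠ σ := fun h => hα'.1 (h ▸ hab.subset (by simp))
      have h2 := h1.erase σ
      have hσ : σ ∉ β₁ := fun h => hβ'.1 (by simp [h])
      rw [List.erase_of_not_mem (by simp [ha.symm, hb.symm]),
        List.erase_append_right _ hσ, List.erase_cons_head] at h2
      exact h2
    · intro τ hτ hc
      have hm : τ ∈ α := (hs' τ).2 (by simp [hτ])
      have h1 := ho σ τ (List.cons_sublist_cons.2 (List.singleton_sublist.2 hm)) hc
      have h2 : List.Sublist ([τ] ++ [σ]) (β₁ ++ σ :: β₂) :=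
        (List.singleton_sublist.2 hτ).append (List.singleton_sublist.2 (by simp))
      exact before_asymm hβ h1 h2

theorem chain_before {A : Set (Cmd N C)} {l : List (Cmd N C)} (hn : l.Nodup)
    (hA : ∀ σ ∈ A, σ ∈ l) (hh : Honors l) {σ τ : Cmd N C} (hne : σ ≠ τ)
    (h : Relation.ReflTransGen (fun a b => a ∈ A ∧ b ∈ A ∧ LL a b) σ τ) :
    List.Sublist [σ, τ] l := by
  rcases Relation.reflTransGen_iff_eq_or_transGen.1 h with h' | h'
  · exact absurd h'.symm hne
  · clear hne h
    induction h' with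
    | single h => exact hh _ (hA _ h.1) _ (hA _ h.2.1) h.2.2
    | tail _ h ih => 
      exact before_trans hn ih (hh _ (hA _ h.1) _ (hA _ h.2.1) h.2.2)

/-- Two canonical sequences with the same command set are
semantically equivalent. -/
theorem stmt_0 {N C : Type} [DecidableEq N] (α β : List (Cmd N C))
    (hα : CanonicalSeq α) (hβ : CanonicalSeq β)
    (hset : ∀ σ : Cmd N C, σ ∈ α ↔ σ ∈ β) :
    SeqEquiv α β := by
  obtain ⟨hnα, hcα, hhα⟩ := hα
  obtain ⟨hnβ, hcβ, hhβ⟩ := hβ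
  refine equiv_of_order α β hnα hnβ hset ?_
  intro σ τ hst hc
  have hσ : σ ∈ α := hst.subset (by simp)
  have hτ : τ ∈ α := hst.subset (by simp)
  have hne : σ ≠ τ := by
    have := hst.nodup hnα
    simpa using this
  have hne' : σ.node ≠ τ.node := fun h => hne (hcα.2.2.1 σ hσ τ hτ h)
  rcases hcα.2.2.2 σ hσ τ hτ hne' hc with h | h
  · exact chain_before hnβ (fun ρ hρ => (hset ρ).1 hρ) hhβ hne h
  · exact (before_asymm hnα hst (chain_before hnα (fun ρ hρ => hρ) hhα hne.symm h)).elim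

end FileSync
end

section
/- Every canonical command sequence is non-breaking: there exists a filesystem that it does not break. -/
namespace FileSync

variable {N C : Type} [DecidableEq N]

/-- The upward shape of a chain from `s` to `t`. -/
def UpC (A : Set (Cmd N C)) (s t : Cmd N C) : Prop :=
  Anc t.node s.node ∧ s.out = Val.empty ∧ s.inp ≠ Val.empty ∧ t.inp = Val.dir ∧ t.out ≠ Val.dir ∧
    ∀ p : Node N, t.node.1 <+: p.1 → p.1 <+: s.node.1 → ∃ ρ ∈ A, ρ.node = p

/-- The downward shape of a chain from `s` to `t`. -/
def DownC (A : Set (Cmd N C)) (s t : Cmd N C) : Prop :=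
  Anc s.node t.node ∧ s.out = Val.dir ∧ s.inp ≠ Val.dir ∧ t.inp = Val.empty ∧ t.out ≠ Val.empty ∧
    ∀ p : Node N, s.node.1 <+: p.1 → p.1 <+: t.node.1 → ∃ ρ ∈ A, ρ.node = p

theorem isParent_anc {p n : Node N} (h : IsParent p n) : Anc p n := by
  obtain ⟨a, ha⟩ := h
  refine ⟨⟨[a], ha.symm⟩, ?_⟩
  rintro rfl
  have := congrArg List.length ha
  simp at this

theorem anc_trans {a b c : Node N} (h : Anc a b) (h' : Anc b c) : Anc a c := by
  refine ⟨h.1.trans h'.1, ?_⟩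
  rintro rfl
  exact h.2 (Subtype.ext (h.1.eq_of_length_le h'.1.length_le))

theorem isParent_between {p n q : Node N} (h : IsParent p n) (h1 : p.1 <+: q.1)
    (h2 : q.1 <+: n.1) : q = p ∨ q = n := by
  obtain ⟨a, ha⟩ := h
  have l1 := h1.length_le
  have l2 := h2.length_le
  have l3 : n.1.length = p.1.length + 1 := by rw [ha]; simp
  by_cases hq : q.1.length ≤ p.1.length
  · exact Or.inl (Subtype.ext (h1.eq_of_length_le hq).symm)
  · exact Or.inr (Subtype.ext (h2.eq_of_length_le (by omega)))

theorem chain_shape {A : Set (Cmd N C)} {s t : Cmd N C}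
    (h : Relation.TransGen (fun a b => a ∈ A ∧ b ∈ A ∧ LL a b) s t) :
    UpC A s t ∨ DownC A s t := by
  induction h with
  | single h =>
    obtain ⟨ha, hb, h | h⟩ := h
    · left
      refine ⟨isParent_anc h.1, h.2.1, h.2.2.1, h.2.2.2.1, h.2.2.2.2, ?_⟩
      intro p h1 h2
      rcases isParent_between h.1 h1 h2 with rfl | rfl
      exacts [⟨_, hb, rfl⟩, ⟨_, ha, rfl⟩]
    · right
      refine ⟨isParent_anc h.1, h.2.1, h.2.2.1, h.2.2.2.1, h.2.2.2.2, ?_⟩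
      intro p h1 h2
      rcases isParent_between h.1 h1 h2 with rfl | rfl
      exacts [⟨_, ha, rfl⟩, ⟨_, hb, rfl⟩]
  | tail _ h ih =>
    obtain ⟨hb, hc, h⟩ := h
    rcases ih with ⟨i1, i2, i3, i4, i5, i6⟩ | ⟨i1, i2, i3, i4, i5, i6⟩
    · rcases h with h | h
      · left
        refine ⟨anc_trans (isParent_anc h.1) i1, i2, i3, h.2.2.2.1, h.2.2.2.2, ?_⟩
        intro p h1 h2
        rcases List.prefix_or_prefix_of_prefix h2 i1.1 with h3 | h3
        · rcases isParent_between h.1 h1 h3 with rfl | rfl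
          exacts [⟨_, hc, rfl⟩, ⟨_, hb, rfl⟩]
        · exact i6 p h3 h2
      · exact absurd h.2.1 i5
    · rcases h with h | h
      · exact absurd h.2.1 i5
      · right
        have hp := isParent_anc h.1
        refine ⟨anc_trans i1 hp, i2, i3, h.2.2.2.1, h.2.2.2.2, ?_⟩
        intro p h1 h2
        rcases List.prefix_or_prefix_of_prefix h2 hp.1 with h3 | h3
        · exact i6 p h1 h3
        · rcases isParent_between h.1 h3 h2 with rfl | rfl
          exacts [⟨_, hb, rfl⟩, ⟨_, hc, rfl⟩]

theorem chain_order {pre rest : List (Cmd N C)} (hnd : (pre ++ rest).Nodup)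
    (hh : Honors (pre ++ rest)) {s t : Cmd N C}
    (h : Relation.ReflTransGen
      (fun a b => a ∈ {σ | σ ∈ pre ++ rest} ∧ b ∈ {σ | σ ∈ pre ++ rest} ∧ LL a b) s t)
    (ht : t ∈ pre) : s ∈ pre := by
  induction h using Relation.ReflTransGen.head_induction_on with
  | refl => exact ht
  | head h _ ih =>
    obtain ⟨ha, hb, hl⟩ := h
    have hs := hh _ ha _ hb hl
    obtain ⟨l1, l2, e, s1, s2⟩ := List.sublist_append_iff.1 hs
    have hdis := (List.nodup_append'.1 hnd).2.2
    rcases l1 with _ | ⟨x, l1⟩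
    · simp only [List.nil_append] at e
      subst e
      exact absurd (s2.subset (by simp)) (hdis ih)
    · simp only [List.cons_append, List.cons.injEq] at e
      rw [e.1]
      exact s1.subset (by simp)

/-- State invariant: `pre` has been executed, `rest` has not. -/
def Inv (f : Node N → Val C) (pre rest : List (Cmd N C)) : Prop :=
  (∀ σ ∈ pre, f σ.node = σ.out) ∧ (∀ σ ∈ rest, f σ.node = σ.inp) ∧
  ∀ n : Node N, (∀ σ ∈ pre ++ rest, σ.node ≠ n) →
    ((∃ σ ∈ pre ++ rest, Anc n σ.node) → f n = Val.dir) ∧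
    ((¬ ∃ σ ∈ pre ++ rest, Anc n σ.node) → f n = Val.empty)

theorem pair_shape {A : Set (Cmd N C)} (hA : Canonical A) {σ τ : Cmd N C} (hσ : σ ∈ A)
    (hτ : τ ∈ A) (h : Anc σ.node τ.node) :
    (UpC A τ σ ∧ Relation.ReflTransGen (fun a b => a ∈ A ∧ b ∈ A ∧ LL a b) τ σ) ∨
    (DownC A σ τ ∧ Relation.ReflTransGen (fun a b => a ∈ A ∧ b ∈ A ∧ LL a b) σ τ) := by
  have hne : σ ≠ τ := fun e => h.2 (by rw [e])
  have anti : ∀ {a b : Node N}, Anc a b → Anc b a → False := fun h1 h2 => (anc_trans h1 h2).2 rfl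
  rcases hA.2.2.2 σ hσ τ hτ h.2 (Or.inl h.1) with hc | hc
  · rcases Relation.reflTransGen_iff_eq_or_transGen.1 hc with e | ht
    · exact absurd e.symm hne
    · rcases chain_shape ht with hs | hs
      · exact (anti h hs.1).elim
      · exact Or.inr ⟨hs, hc⟩
  · rcases Relation.reflTransGen_iff_eq_or_transGen.1 hc with e | ht
    · exact absurd e hne
    · rcases chain_shape ht with hs | hs
      · exact Or.inl ⟨hs, hc⟩
      · exact (anti h hs.1).elim

theorem inv_valid {f : Node N → Val C} {pre rest : List (Cmd N C)}
    (hα : CanonicalSeq (pre ++ rest)) (hI : Inv f pre rest) : ValidFS f := by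
  obtain ⟨hnd, hA, hh⟩ := hα
  obtain ⟨hp, hr, hu⟩ := hI
  constructor
  · have hfin : (⋃ σ ∈ {σ | σ ∈ pre ++ rest}, {n : Node N | n.1 <+: σ.node.1}).Finite := by
      refine Set.Finite.biUnion (List.finite_toSet _) ?_
      intro σ _
      have : {n : Node N | n.1 <+: σ.node.1} = Subtype.val ⁻¹' {l | l ∈ σ.node.1.inits} := by
        ext n; simp
      rw [this]
      exact (List.finite_toSet _).preimage Subtype.val_injective.injOn
    refine hfin.subset ?_
    intro n hn
    simp only [Set.mem_iUnion, Set.mem_setOf_eq, exists_prop]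
    by_contra hcon
    push Not at hcon
    refine hn ((hu n ?_).2 ?_)
    · rintro σ hσ rfl
      exact hcon σ hσ (List.prefix_refl _)
    · rintro ⟨σ, hσ, ha⟩
      exact hcon σ hσ ha.1
  · intro n m hmn hn
    by_cases hmM : ∃ σ ∈ pre ++ rest, σ.node = m
    · obtain ⟨σ, hσ, rfl⟩ := hmM
      by_cases hnM : ∃ τ ∈ pre ++ rest, τ.node = n
      · obtain ⟨τ, hτ, rfl⟩ := hnM
        rcases pair_shape hA hσ hτ hmn with ⟨hs, hc⟩ | ⟨hs, hc⟩
        · have : τ ∉ pre := fun h => hn (by rw [hp τ h, hs.2.1])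
          have hσp : σ ∉ pre := fun h => this (chain_order hnd hh hc h)
          have : σ ∈ rest := by simpa [hσp] using hσ
          rw [hr σ this, hs.2.2.2.1]
        · have : τ ∉ rest := fun h => hn (by rw [hr τ h, hs.2.2.2.1])
          have hτp : τ ∈ pre := by simpa [this] using hτ
          rw [hp σ (chain_order hnd hh hc hτp), hs.2.1]
      · exfalso
        have hnM' : ∀ σ ∈ pre ++ rest, σ.node ≠ n := fun τ h e => hnM ⟨τ, h, e⟩
        by_cases hex : ∃ ρ ∈ pre ++ rest, Anc n ρ.node
        · obtain ⟨ρ, hρ, ha⟩ := hex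
          rcases pair_shape hA hσ hρ (anc_trans hmn ha) with ⟨hs, -⟩ | ⟨hs, -⟩
          · exact hnM (hs.2.2.2.2.2 n hmn.1 ha.1)
          · exact hnM (hs.2.2.2.2.2 n hmn.1 ha.1)
        · exact hn ((hu n hnM').2 hex)
    · have hmM' : ∀ σ ∈ pre ++ rest, σ.node ≠ m := fun τ h e => hmM ⟨τ, h, e⟩
      refine (hu m hmM').1 ?_
      by_cases hnM : ∃ τ ∈ pre ++ rest, τ.node = n
      · obtain ⟨τ, hτ, rfl⟩ := hnM
        exact ⟨τ, hτ, hmn⟩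
      · have hnM' : ∀ σ ∈ pre ++ rest, σ.node ≠ n := fun τ h e => hnM ⟨τ, h, e⟩
        by_cases hex : ∃ ρ ∈ pre ++ rest, Anc n ρ.node
        · obtain ⟨ρ, hρ, ha⟩ := hex
          exact ⟨ρ, hρ, anc_trans hmn ha⟩
        · exact absurd ((hu n hnM').2 hex) hn

theorem inv_step {f : Node N → Val C} {pre rest : List (Cmd N C)} {σ : Cmd N C}
    (hα : CanonicalSeq (pre ++ σ :: rest)) (hI : Inv f pre (σ :: rest)) :
    Inv (upd f σ) (pre ++ [σ]) rest := by
  obtain ⟨hnd, hA, hh⟩ := hα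
  obtain ⟨hp, hr, hu⟩ := hI
  have huniq := hA.2.2.1
  have hsA : σ ∈ pre ++ σ :: rest := by simp
  refine ⟨?_, ?_, ?_⟩
  · intro τ hτ
    by_cases e : τ.node = σ.node
    · have : τ = σ := huniq τ (by simp at hτ ⊢; tauto) σ hsA e
      simp [upd, this]
    · have : τ ∈ pre := by
        rcases List.mem_append.1 hτ with h | h
        · exact h
        · exact absurd (by rw [List.mem_singleton.1 h]) e
      simp [upd, e, hp τ this]
  · intro τ hτ
    have e : τ.node ≠ σ.node := by
      intro e
      have : τ = σ := huniq τ (by simp [hτ]) σ hsA e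
      subst this
      have := (List.nodup_append'.1 hnd).2.1
      exact (List.nodup_cons.1 this).1 hτ
    simp [upd, e, hr τ (by simp [hτ])]
  · intro n hn
    have e : n ≠ σ.node := fun e => hn σ (by simp) e.symm
    rw [List.append_assoc, List.singleton_append] at hn ⊢
    simpa [upd, e] using hu n hn

theorem inv_seqOK (rest : List (Cmd N C)) : ∀ (pre : List (Cmd N C)) (f : Node N → Val C),
    CanonicalSeq (pre ++ rest) → Inv f pre rest → SeqOK rest f := by
  induction rest with
  | nil => intros; trivial
  | cons σ rest ih =>
    intro pre f hα hI
    have hI' := inv_step hα hI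
    have hα' : CanonicalSeq ((pre ++ [σ]) ++ rest) := by simpa using hα
    exact ⟨hI.2.1 σ (by simp), inv_valid hα' hI', ih _ _ hα' hI'⟩

/-- Every canonical command sequence is non-breaking. -/
theorem stmt_1 {N C : Type} [DecidableEq N] (α : List (Cmd N C))
    (hα : CanonicalSeq α) :
    NonBreaking α := by
  classical
  have key : ∃ f : Node N → Val C, Inv f [] α := by
    refine ⟨fun n => if h : ∃ σ ∈ α, σ.node = n then h.choose.inp
      else if ∃ σ ∈ α, Anc n σ.node then Val.dir else Val.empty, ?_, ?_, ?_⟩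
    · simp
    · intro σ hσ
      have h : ∃ τ ∈ α, τ.node = σ.node := ⟨σ, hσ, rfl⟩
      have e : h.choose = σ :=
        hα.2.1.2.2.1 _ h.choose_spec.1 _ hσ h.choose_spec.2
      simp only [dif_pos h, e]
    · intro n hn
      have h : ¬ ∃ σ ∈ α, σ.node = n := by
        rintro ⟨σ, h, e⟩
        exact hn σ h e
      simp only [dif_neg h, List.nil_append]
      exact ⟨fun h => if_pos h, fun h => if_neg h⟩
  obtain ⟨f, hf⟩ := key
  exact ⟨f, inv_valid (pre := []) hα hf, inv_seqOK α [] f hα hf⟩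

end FileSync
end

section
/- For every non-breaking command sequence α there exists a canonical command sequence α* that semantically extends α, i.e., α ≤ α*: for every filesystem FS that α does not break, α* does not break FS and α*FS = αFS. -/
namespace FileSync

variable {N C : Type} [DecidableEq N]

open Classical in
/-- Sorting key: removals first (deepest first), then constructions (shallowest first). -/
noncomputable def key (σ : Cmd N C) : ℤ :=
  if σ.out = Val.empty ∨ σ.inp = Val.dir then -(σ.node.1.length : ℤ) else (σ.node.1.length : ℤ)

theorem anc_length {m n : Node N} (h : Anc m n) : m.1.length < n.1.length := by
  obtain ⟨⟨s, hs⟩, hne⟩ := h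
  have : s ≠ [] := by
    rintro rfl
    exact hne (Subtype.ext (by simpa using hs))
  have := List.length_pos_iff.2 this
  rw [← hs, List.length_append]
  omega

theorem LL_key {σ τ : Cmd N C} (h : LL σ τ) : key σ < key τ := by
  unfold key
  rcases h with ⟨⟨a, ha⟩, h1, h2, h3, h4⟩ | ⟨⟨a, ha⟩, h1, h2, h3, h4⟩
  · simp [h1, h3, ha]
  · simp [h1, h2, h3, h4, ha]

theorem pair_sublist {σ τ : Cmd N C} (hk : key σ < key τ) :
    ∀ l : List (Cmd N C), l.Pairwise (fun a b => key a ≤ key b) → σ ∈ l → τ ∈ l →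
      List.Sublist [σ, τ] l
  | [], _, h, _ => by simp at h
  | a :: t, hp, hs, ht => by
    rw [List.pairwise_cons] at hp
    rcases List.mem_cons.1 hs with rfl | hs2
    · rcases List.mem_cons.1 ht with rfl | ht2
      · exact absurd hk (lt_irrefl _)
      · exact List.Sublist.cons_cons _ (List.singleton_sublist.2 ht2)
    · rcases List.mem_cons.1 ht with rfl | ht2
      · exact absurd hk (not_lt.2 (hp.1 _ hs2))
      · exact (pair_sublist hk t hp.2 hs2 ht2).cons _

theorem valid_apply : ∀ (α : List (Cmd N C)) (f : Node N → Val C), ValidFS f → SeqOK α f →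
    ValidFS (applySeq α f)
  | [], _, h, _ => h
  | _ :: t, _, _, h => valid_apply t _ h.2.1 h.2.2

theorem untouched : ∀ (α : List (Cmd N C)) (f : Node N → Val C) (n : Node N),
    (∀ σ ∈ α, σ.node ≠ n) → applySeq α f n = f n
  | [], _, _, _ => rfl
  | σ :: t, f, n, h => by
    have h1 := untouched t (upd f σ) n (fun τ hτ => h τ (List.mem_cons_of_mem _ hτ))
    have h2 := h σ List.mem_cons_self
    simp only [applySeq, h1, upd]
    rw [if_neg (Ne.symm h2)]

theorem touched_in : ∀ (α : List (Cmd N C)) (f f' : Node N → Val C) (n : Node N),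
    SeqOK α f → SeqOK α f' → (∃ σ ∈ α, σ.node = n) → f n = f' n
  | [], _, _, _, _, _, h => by simp at h
  | σ :: t, f, f', n, h, h', hn => by
    by_cases hs : n = σ.node
    · rw [hs, h.1, h'.1]
    · have := touched_in t (upd f σ) (upd f' σ) n h.2.2 h'.2.2 (by
        obtain ⟨τ, hτ, rfl⟩ := hn
        rcases List.mem_cons.1 hτ with rfl | hτ
        · exact absurd rfl hs
        · exact ⟨τ, hτ, rfl⟩)
      simpa [upd, hs] using this

theorem apply_congr : ∀ (α : List (Cmd N C)) (f f' : Node N → Val C) (n : Node N),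
    f n = f' n → applySeq α f n = applySeq α f' n
  | [], _, _, _, h => h
  | σ :: t, f, f', n, h => by
    apply apply_congr t
    simp [upd, h]

theorem step_valid {f g : Node N → Val C} (hf : ValidFS f) (hg : ValidFS g) (σ : Cmd N C)
    (hi : f σ.node = σ.inp) (ho : g σ.node = σ.out)
    (hmin : ∀ n, f n ≠ g n → key σ ≤ key ⟨n, f n, g n⟩) : ValidFS (upd f σ) := by
  constructor
  · refine (hf.1.union (Set.finite_singleton σ.node)).subset ?_
    intro n hn
    by_cases h : n = σ.node
    · exact Or.inr h
    · left
      simpa [upd, h] using hn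
  · intro n m hmn hn
    have hlen := anc_length hmn
    have hne := hmn.2
    by_cases hm : m = σ.node
    · subst hm
      have hn' : f n ≠ Val.empty := by simpa [upd, Ne.symm hne] using hn
      have hd := hf.2 _ _ hmn hn'
      simp only [upd, if_true]
      by_contra hD
      have hgn : g n = Val.empty := by
        by_contra hc
        exact hD (ho ▸ hg.2 _ _ hmn hc)
      have := hmin n (by rw [hgn]; exact hn')
      have hinp : σ.inp = Val.dir := hi ▸ hd
      simp [key, hgn, hinp] at this
      omega
    · by_cases hns : n = σ.node
      · subst hns
        have hn' : g σ.node ≠ Val.empty := by simpa [upd, ho] using hn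
        have hd := hg.2 _ _ hmn hn'
        simp only [upd, hm, if_false]
        by_contra hD
        have hfn : f σ.node = Val.empty := by
          by_contra hc
          exact hD (hf.2 _ _ hmn hc)
        have := hmin m (by rw [hd]; exact hD)
        have hinp : σ.inp = Val.empty := hi ▸ hfn
        have hout : σ.out ≠ Val.empty := ho ▸ hn'
        simp [key, hd, hinp, hout, hD] at this
        omega
      · simp only [upd, hm, hns, if_false] at hn ⊢
        exact hf.2 _ _ hmn hn

theorem sorted_ok {g : Node N → Val C} (hg : ValidFS g) :
    ∀ (l : List (Cmd N C)) (f : Node N → Val C), ValidFS f →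
      l.Pairwise (fun a b => key a ≤ key b) → l.Pairwise (fun a b => a.node ≠ b.node) →
      (∀ σ ∈ l, f σ.node = σ.inp ∧ g σ.node = σ.out) →
      (∀ n, f n ≠ g n → (⟨n, f n, g n⟩ : Cmd N C) ∈ l) →
      SeqOK l f ∧ applySeq l f = g
  | [], f, _, _, _, _, h => by
    refine ⟨trivial, ?_⟩
    funext n
    by_contra hc
    simpa using h n hc
  | σ :: t, f, hf, hp, hq, hm, hall => by
    rw [List.pairwise_cons] at hp hq
    have hσ := hm σ List.mem_cons_self
    have hv : ValidFS (upd f σ) := by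
      refine step_valid hf hg σ hσ.1 hσ.2 ?_
      intro n hn
      rcases List.mem_cons.1 (hall n hn) with h | h
      · rw [h]
      · exact hp.1 _ h
    have := sorted_ok hg t (upd f σ) hv hp.2 hq.2 (by
      intro τ hτ
      have h1 := hm τ (List.mem_cons_of_mem _ hτ)
      have h2 := hq.1 τ hτ
      simpa [upd, Ne.symm h2] using h1) (by
      intro n hn
      by_cases h : n = σ.node
      · subst h
        simp [upd, hσ.2] at hn
      · simp only [upd, h, if_false] at hn ⊢
        rcases List.mem_cons.1 (hall n hn) with h' | h'
        · exact absurd (by rw [← h']) h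
        · exact h')
    exact ⟨⟨hσ.1, hv, this.1⟩, this.2⟩

theorem valid_prefix {f : Node N → Val C} (hf : ValidFS f) {m n : Node N} (h : m.1 <+: n.1)
    (hn : f n = Val.dir) : f m = Val.dir := by
  by_cases he : m = n
  · rw [he, hn]
  · exact hf.2 n m ⟨h, he⟩ (by simp [hn])

/-- The basic facts along a path below a node that stops being a directory. -/
theorem chain_facts {f g : Node N → Val C} (hf : ValidFS f) (hg : ValidFS g)
    {n p m : Node N} (hnp : n.1 <+: p.1) (hpm : IsParent p m)
    (hgn : g n ≠ Val.dir) (hfm : f m ≠ Val.empty) :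
    f p = Val.dir ∧ g p ≠ Val.dir ∧ g m = Val.empty := by
  obtain ⟨a, ha⟩ := hpm
  have hanc : Anc p m := by
    refine ⟨⟨[a], ha.symm⟩, ?_⟩
    rintro rfl
    simpa using congrArg List.length ha
  have h1 : g p ≠ Val.dir := fun h => hgn (valid_prefix hg hnp h)
  refine ⟨hf.2 _ _ hanc hfm, h1, ?_⟩
  by_contra hc
  exact h1 (hg.2 _ _ hanc hc)

theorem chain_down {f g : Node N → Val C} (hf : ValidFS f) (hg : ValidFS g)
    {A : Set (Cmd N C)} (hA : ∀ n, f n ≠ g n → (⟨n, f n, g n⟩ : Cmd N C) ∈ A)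
    (n : Node N) (hgn : g n ≠ Val.dir) (s : List N) :
    ∀ m : Node N, m.1 = n.1 ++ s → f m ≠ Val.empty →
    Relation.ReflTransGen (fun a b => a ∈ A ∧ b ∈ A ∧ LL a b)
      (⟨m, f m, g m⟩ : Cmd N C) ⟨n, f n, g n⟩ := by
  induction s using List.reverseRecOn with
  | nil =>
    intro m hm _
    have : m = n := Subtype.ext (by simpa using hm)
    rw [this]
  | append_singleton t a ih =>
    intro m hm hfm
    let p : Node N := ⟨n.1 ++ t, by simp [n.2]⟩
    have hpm : IsParent p m := ⟨a, by simp [p, hm]⟩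
    obtain ⟨h1, h2, h3⟩ := chain_facts hf hg (n := n) (p := p) ⟨t, rfl⟩ hpm hgn hfm
    refine Relation.ReflTransGen.head ⟨hA m (by rw [h3]; exact hfm),
      hA p (by rw [h1]; exact h2.symm), Or.inl ⟨hpm, h3, hfm, h1, h2⟩⟩ (ih p rfl (by simp [h1]))

theorem chain_up {f g : Node N → Val C} (hf : ValidFS f) (hg : ValidFS g)
    {A : Set (Cmd N C)} (hA : ∀ n, f n ≠ g n → (⟨n, f n, g n⟩ : Cmd N C) ∈ A)
    (n : Node N) (hfn : f n ≠ Val.dir) (s : List N) :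
    ∀ m : Node N, m.1 = n.1 ++ s → g m ≠ Val.empty →
    Relation.ReflTransGen (fun a b => a ∈ A ∧ b ∈ A ∧ LL a b)
      (⟨n, f n, g n⟩ : Cmd N C) ⟨m, f m, g m⟩ := by
  induction s using List.reverseRecOn with
  | nil =>
    intro m hm _
    have : m = n := Subtype.ext (by simpa using hm)
    rw [this]
  | append_singleton t a ih =>
    intro m hm hgm
    let p : Node N := ⟨n.1 ++ t, by simp [n.2]⟩
    have hpm : IsParent p m := ⟨a, by simp [p, hm]⟩
    obtain ⟨h1, h2, h3⟩ := chain_facts hg hf (n := n) (p := p) ⟨t, rfl⟩ hpm hfn hgm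
    refine Relation.ReflTransGen.tail (ih p rfl (by simp [h1])) ⟨hA p (by rw [h1]; exact h2),
      hA m (by rw [h3]; exact hgm.symm), Or.inr ⟨hpm, h1, h2, h3, hgm⟩⟩

theorem connected {f g : Node N → Val C} (hf : ValidFS f) (hg : ValidFS g)
    {A : Set (Cmd N C)} (hA : ∀ n, f n ≠ g n → (⟨n, f n, g n⟩ : Cmd N C) ∈ A)
    {n m : Node N} (hn : f n ≠ g n) (hm : f m ≠ g m) (h : Anc n m) :
    Relation.ReflTransGen (fun a b => a ∈ A ∧ b ∈ A ∧ LL a b)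
      (⟨n, f n, g n⟩ : Cmd N C) ⟨m, f m, g m⟩ ∨
    Relation.ReflTransGen (fun a b => a ∈ A ∧ b ∈ A ∧ LL a b)
      (⟨m, f m, g m⟩ : Cmd N C) ⟨n, f n, g n⟩ := by
  obtain ⟨s, hs⟩ := h.1
  by_cases hfm : f m = Val.empty
  · left
    have hgm : g m ≠ Val.empty := by rw [← hfm]; exact hm.symm
    have hd := hg.2 _ _ h hgm
    exact chain_up hf hg hA n (by rw [← hd]; exact hn) s m hs.symm hgm
  · right
    have hd := hf.2 _ _ h hfm
    exact chain_down hf hg hA n (by rw [← hd]; exact hn.symm) s m hs.symm hfm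

/-- Every non-breaking sequence has a canonical sequence semantically
extending it. -/
theorem stmt_2 {N C : Type} [DecidableEq N] (α : List (Cmd N C))
    (h : NonBreaking α) :
    ∃ β : List (Cmd N C), CanonicalSeq β ∧ SeqExt α β := by
  obtain ⟨f, hf, hα⟩ := h
  obtain ⟨g, hgdef⟩ : ∃ g, g = applySeq α f := ⟨_, rfl⟩
  have hg : ValidFS g := hgdef ▸ valid_apply α f hf hα
  have hfin : {n : Node N | f n ≠ g n}.Finite := by
    refine (hf.1.union hg.1).subset ?_
    intro n hn
    by_cases h : f n = Val.empty
    · right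
      intro h'
      exact hn (h.trans h'.symm)
    · exact Or.inl h
  let L : List (Cmd N C) := hfin.toFinset.toList.map (fun n => ⟨n, f n, g n⟩)
  let β : List (Cmd N C) := L.mergeSort (fun a b => decide (key a ≤ key b))
  have hperm : β.Perm L := List.mergeSort_perm _ _
  have hsort : β.Pairwise (fun a b => key a ≤ key b) := by
    have := List.pairwise_mergeSort (le := fun a b : Cmd N C => decide (key a ≤ key b))
      (by intro a b c h1 h2; simp only [decide_eq_true_eq] at *; exact h1.trans h2)
      (by intro a b; simpa using le_total (key a) (key b)) L
    simpa using this
  have hnode : β.Pairwise (fun a b => a.node ≠ b.node) := by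
    have hL : L.Pairwise (fun a b => a.node ≠ b.node) := by
      rw [List.pairwise_map]
      exact hfin.toFinset.nodup_toList
    exact (hperm.pairwise_iff (fun h => Ne.symm h)).2 hL
  have hmem : ∀ σ, σ ∈ β ↔ ∃ n, f n ≠ g n ∧ (⟨n, f n, g n⟩ : Cmd N C) = σ := by
    intro σ
    rw [hperm.mem_iff]
    simp [L]
  have hA : ∀ n, f n ≠ g n → (⟨n, f n, g n⟩ : Cmd N C) ∈ {σ | σ ∈ β} :=
    fun n hn => (hmem _).2 ⟨n, hn, rfl⟩
  refine ⟨β, ⟨?_, ⟨List.finite_toSet β, ?_, ?_, ?_⟩, ?_⟩, ?_⟩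
  · exact hnode.imp (fun h h' => h (by rw [h']))
  · intro σ hσ
    obtain ⟨n, hn, rfl⟩ := (hmem σ).1 hσ
    exact hn
  · intro σ hσ τ hτ h
    obtain ⟨n, hn, rfl⟩ := (hmem σ).1 hσ
    obtain ⟨m, hm, rfl⟩ := (hmem τ).1 hτ
    have h : n = m := h
    rw [h]
  · intro σ hσ τ hτ hne hc
    obtain ⟨n, hn, rfl⟩ := (hmem σ).1 hσ
    obtain ⟨m, hm, rfl⟩ := (hmem τ).1 hτ
    rcases hc with hc | hc
    · exact connected hf hg hA hn hm ⟨hc, hne⟩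
    · exact (connected hf hg hA hm hn ⟨hc, Ne.symm hne⟩).symm
  · intro σ hσ τ hτ h
    exact pair_sublist (LL_key h) β hsort hσ hτ
  · intro f' hf' hα'
    have key1 : ∀ n, (∃ σ ∈ α, σ.node = n) → f' n = f n ∧ applySeq α f' n = g n := by
      intro n hn
      have h1 := touched_in α f' f n hα' hα hn
      exact ⟨h1, hgdef ▸ apply_congr α f' f n h1⟩
    have key2 : ∀ n, (¬ ∃ σ ∈ α, σ.node = n) → applySeq α f' n = f' n ∧ g n = f n := by
      intro n hn
      push Not at hn
      exact ⟨untouched α f' n hn, hgdef ▸ untouched α f n hn⟩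
    refine sorted_ok (valid_apply α f' hf' hα') β f' hf' hsort hnode ?_ ?_
    · intro σ hσ
      obtain ⟨n, hn, rfl⟩ := (hmem σ).1 hσ
      by_cases ht : ∃ σ ∈ α, σ.node = n
      · exact key1 n ht
      · exact absurd (key2 n ht).2.symm hn
    · intro n hn
      by_cases ht : ∃ σ ∈ α, σ.node = n
      · obtain ⟨h1, h2⟩ := key1 n ht
        rw [h1, h2] at hn ⊢
        exact hA n hn
      · exact absurd (key2 n ht).1.symm hn

end FileSync
end

section
/- Every canonical command set can be ordered into a canonical sequence, i.e., its commands can be arranged in a linear order that honors ≪. -/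
namespace FileSync

variable {N C : Type} [DecidableEq N]

/-- Rank: minus the depth for destructors, the depth otherwise. -/
noncomputable def rankKey {N C : Type} (σ : Cmd N C) : ℤ :=
  if vtype σ.out < vtype σ.inp then -(σ.node.1.length : ℤ) else (σ.node.1.length : ℤ)

theorem rankKey_lt {N C : Type} (σ τ : Cmd N C) (h : LL σ τ) : rankKey σ < rankKey τ := by
  obtain ⟨n, x, y⟩ := σ
  obtain ⟨m, z, w⟩ := τ
  rcases h with ⟨⟨a, ha⟩, h1, h2, h3, h4⟩ | ⟨⟨a, ha⟩, h1, h2, h3, h4⟩ <;>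
    simp only at ha h1 h2 h3 h4 <;>
    subst h1 h3 <;>
    have hl := congrArg List.length ha <;>
    cases x <;> cases w <;> simp_all [rankKey, vtype]

theorem pair_sublist_s3 {T : Type} (f : T → ℤ) (l : List T)
    (hl : l.Pairwise (fun a b => f a ≤ f b)) (a b : T) (ha : a ∈ l) (hb : b ∈ l)
    (h : f a < f b) : List.Sublist [a, b] l := by
  induction l with
  | nil => simp at ha
  | cons c l ih =>
    rw [List.pairwise_cons] at hl
    rcases List.mem_cons.1 ha with rfl | ha'
    · rcases List.mem_cons.1 hb with rfl | hb'
      · exact absurd h (lt_irrefl _)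
      · exact List.Sublist.cons_cons _ (List.singleton_sublist.2 hb')
    · rcases List.mem_cons.1 hb with rfl | hb'
      · exact absurd h (not_lt.2 (hl.1 _ ha'))
      · exact List.Sublist.cons _ (ih hl.2 ha' hb')

/-- Every canonical set can be arranged into a canonical sequence. -/
theorem stmt_3 {N C : Type} [DecidableEq N] (A : Set (Cmd N C))
    (hA : Canonical A) :
    ∃ α : List (Cmd N C), Orders A α ∧ CanonicalSeq α := by
  classical
  have hfin := hA.1
  let l := hfin.toFinset.toList.mergeSort (fun a b => decide (rankKey a ≤ rankKey b))
  have hperm : l.Perm hfin.toFinset.toList := List.mergeSort_perm _ _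
  have hnd : l.Nodup := hperm.nodup_iff.2 (Finset.nodup_toList _)
  have hmem : ∀ σ : Cmd N C, σ ∈ l ↔ σ ∈ A := by
    intro σ
    rw [hperm.mem_iff]
    simp
  have hs : l.Pairwise (fun a b => rankKey a ≤ rankKey b) := by
    have h := List.pairwise_mergeSort
      (le := fun a b : Cmd N C => decide (rankKey a ≤ rankKey b))
      (by intro a b c h1 h2; simp only [decide_eq_true_eq] at *; exact h1.trans h2)
      (by intro a b; simpa using le_total (rankKey a) (rankKey b)) hfin.toFinset.toList
    exact h.imp (by intro a b hab; simpa using hab)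
  have hh : Honors l := fun σ hσ τ hτ h =>
    pair_sublist_s3 rankKey l hs σ τ hσ hτ (rankKey_lt σ τ h)
  have hset : {σ : Cmd N C | σ ∈ l} = A := Set.ext hmem
  exact ⟨l, ⟨hnd, hmem, hh⟩, hnd, by rw [hset]; exact hA, hh⟩

end FileSync
end

section
/- A canonical command set A does not break the filesystem FS if and only if the following conditions hold for every command σ = ⟨n,x,y⟩ ∈ A: (a) FS(n) = x; (b) if σ is a destructor, then FS(n′) = E at every node n′ strictly below n on which A has no command; (c) if σ is a constructor, then FS(n′) = D at every node n′ strictly above n on which A has no command. -/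
namespace FileSync

variable {N C : Type} [DecidableEq N]

def UpRel (σ τ : Cmd N C) : Prop :=
  Anc τ.node σ.node ∧ σ.out = Val.empty ∧ σ.inp ≠ Val.empty ∧ τ.inp = Val.dir ∧ τ.out ≠ Val.dir

def DownRel (σ τ : Cmd N C) : Prop :=
  Anc σ.node τ.node ∧ σ.out = Val.dir ∧ σ.inp ≠ Val.dir ∧ τ.inp = Val.empty ∧ τ.out ≠ Val.empty

theorem anc_of_parent {N : Type} {p n : Node N} (h : IsParent p n) : Anc p n := by
  obtain ⟨a, ha⟩ := h
  refine ⟨⟨[a], ha.symm⟩, ?_⟩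
  rintro rfl
  have := congrArg List.length ha
  simp at this

theorem anc_len {N : Type} {p n : Node N} (h : Anc p n) : p.1.length < n.1.length := by
  obtain ⟨h1, h2⟩ := h
  rcases Nat.lt_or_ge p.1.length n.1.length with h | h
  · exact h
  · exact absurd (Subtype.ext (h1.eq_of_length_le h)) h2

theorem anc_trans_s5 {N : Type} {p n q : Node N} (h : Anc p n) (h' : Anc n q) : Anc p q := by
  refine ⟨h.1.trans h'.1, ?_⟩
  rintro rfl
  have := anc_len h
  have := anc_len h'
  omega

theorem anc_asymm {N : Type} {p n : Node N} (h : Anc p n) (h' : Anc n p) : False := by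
  have := anc_len h
  have := anc_len h'
  omega

theorem ll_ud {N C : Type} {σ τ : Cmd N C} (h : LL σ τ) : UpRel σ τ ∨ DownRel σ τ := by
  rcases h with ⟨h, r⟩ | ⟨h, r⟩
  · exact Or.inl ⟨anc_of_parent h, r⟩
  · exact Or.inr ⟨anc_of_parent h, r⟩

theorem chain_ud {N C : Type} {A : Set (Cmd N C)} {σ τ : Cmd N C}
    (h : Relation.ReflTransGen (fun a b => a ∈ A ∧ b ∈ A ∧ LL a b) σ τ) :
    σ = τ ∨ UpRel σ τ ∨ DownRel σ τ := by
  induction h with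
  | refl => exact Or.inl rfl
  | tail _ h ih =>
    have h := ll_ud h.2.2
    rcases ih with rfl | ih
    · exact Or.inr h
    · right
      rcases ih with ⟨a, b, c, d, e⟩ | ⟨a, b, c, d, e⟩ <;>
        rcases h with ⟨a', b', c', d', e'⟩ | ⟨a', b', c', d', e'⟩
      · exact Or.inl ⟨anc_trans_s5 a' a, b, c, d', e'⟩
      · exact absurd b' e
      · exact absurd d c'
      · exact Or.inr ⟨anc_trans_s5 a a', b, c, d', e'⟩

open Classical in
theorem idx_lt {α : Type} {a b : α} {l : List α} (hn : l.Nodup) (h : List.Sublist [a, b] l) :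
    l.idxOf a < l.idxOf b := by
  induction l with
  | nil => simp at h
  | cons c l ih =>
    rw [List.nodup_cons] at hn
    cases h with
    | cons _ h =>
      have ha : a ∈ l := h.subset (by simp)
      have hb : b ∈ l := h.subset (by simp)
      have h1 : c ≠ a := fun e => hn.1 (e ▸ ha)
      have h2 : c ≠ b := fun e => hn.1 (e ▸ hb)
      rw [List.idxOf_cons_ne _ h1, List.idxOf_cons_ne _ h2]
      exact Nat.succ_lt_succ (ih hn.2 h)
    | cons_cons _ h =>
      have hb : b ∈ l := h.subset (by simp)
      have h2 : a ≠ b := fun e => hn.1 (e ▸ hb)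
      rw [List.idxOf_cons_ne _ h2, List.idxOf_cons_self]
      exact Nat.succ_pos _

open Classical in
theorem chain_idx {N C : Type} {A : Set (Cmd N C)} {l : List (Cmd N C)} (ho : Orders A l)
    {σ τ : Cmd N C}
    (h : Relation.ReflTransGen (fun a b => a ∈ A ∧ b ∈ A ∧ LL a b) σ τ) :
    l.idxOf σ ≤ l.idxOf τ := by
  induction h with
  | refl => exact le_rfl
  | tail _ h ih =>
    exact ih.trans (idx_lt ho.1
      (ho.2.2 _ ((ho.2.1 _).2 h.1) _ ((ho.2.1 _).2 h.2.1) h.2.2)).le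

/-- The invariant carried along an arrangement of a canonical set. -/
def Good (l : List (Cmd N C)) : Prop :=
  (∀ σ ∈ l, σ.inp ≠ σ.out) ∧
  l.Pairwise (fun σ τ => σ.node ≠ τ.node ∧
    (NodesComparable σ.node τ.node → UpRel σ τ ∨ DownRel σ τ))

open Classical in
theorem good_of_orders {N C : Type} {A : Set (Cmd N C)} (hA : Canonical A)
    {l : List (Cmd N C)} (ho : Orders A l) : Good l := by
  refine ⟨fun σ hσ => hA.2.1 σ ((ho.2.1 _).1 hσ), ?_⟩
  rw [List.pairwise_iff_getElem]
  intro i j hi hj hij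
  have mi : l[i] ∈ A := (ho.2.1 _).1 (List.getElem_mem hi)
  have mj : l[j] ∈ A := (ho.2.1 _).1 (List.getElem_mem hj)
  have hne : l[i] ≠ l[j] := by
    intro e
    have := (ho.1.getElem_inj_iff).1 e
    omega
  have hnn : l[i].node ≠ l[j].node := fun e => hne (hA.2.2.1 _ mi _ mj e)
  refine ⟨hnn, fun hc => ?_⟩
  rcases hA.2.2.2 _ mi _ mj hnn hc with h | h
  · exact (chain_ud h).resolve_left hne
  · have := chain_idx ho h
    rw [ho.1.idxOf_getElem _ hi, ho.1.idxOf_getElem _ hj] at this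
    omega

/-- The conditions (a), (b), (c). -/
def Cond (l : List (Cmd N C)) (f : Node N → Val C) : Prop :=
  ∀ σ ∈ l,
    f σ.node = σ.inp ∧
    (vtype σ.out < vtype σ.inp →
      ∀ n' : Node N, Anc σ.node n' → (∀ ρ ∈ l, ρ.node ≠ n') → f n' = Val.empty) ∧
    (vtype σ.inp < vtype σ.out →
      ∀ n' : Node N, Anc n' σ.node → (∀ ρ ∈ l, ρ.node ≠ n') → f n' = Val.dir)

theorem upd_ne {f : Node N → Val C} {σ : Cmd N C} {m : Node N} (h : m ≠ σ.node) :
    upd f σ m = f m := by simp [upd, h]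

theorem upd_self {f : Node N → Val C} {σ : Cmd N C} : upd f σ σ.node = σ.out := by simp [upd]

theorem destr_out {x y : Val C} (h : vtype y < vtype x) : y ≠ Val.dir ∧ x ≠ Val.empty := by
  cases x <;> cases y <;> simp_all [vtype]

theorem lt_of_dir {y : Val C} (h : y ≠ Val.dir) : vtype y < vtype (Val.dir : Val C) := by
  cases y <;> simp_all [vtype]

theorem lt_of_empty {y : Val C} (h : y ≠ Val.empty) : vtype (Val.empty : Val C) < vtype y := by
  cases y <;> simp_all [vtype]

theorem cond_of_ok {l : List (Cmd N C)} (hl : l.Pairwise (fun σ τ => σ.node ≠ τ.node)) :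
    ∀ f : Node N → Val C, SeqOK l f → Cond l f := by
  induction l with
  | nil => intro f _ σ h; simp at h
  | cons τ l ih =>
    intro f ⟨h1, h2, h3⟩ σ hσ
    rw [List.pairwise_cons] at hl
    rcases List.mem_cons.1 hσ with rfl | hm
    · refine ⟨h1, fun hd n' ha hn => ?_, fun hd n' ha hn => ?_⟩
      · have hne : n' ≠ σ.node := fun e => hn σ (by simp) e.symm
        by_contra hc
        have := h2.2 n' σ.node ha (by rwa [upd_ne hne])
        rw [upd_self] at this
        exact (destr_out hd).1 this
      · have hne : n' ≠ σ.node := fun e => hn σ (by simp) e.symm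
        have := h2.2 σ.node n' ha (by rw [upd_self]; exact (destr_out hd).2)
        rwa [upd_ne hne] at this
    · obtain ⟨a, b, c⟩ := ih hl.2 _ h3 σ hm
      rw [upd_ne (fun e => hl.1 σ hm e.symm)] at a
      refine ⟨a, fun hd n' ha hn => ?_, fun hd n' ha hn => ?_⟩
      · have hne : n' ≠ τ.node := fun e => hn τ (by simp) e.symm
        rw [← b hd n' ha (fun ρ hρ => hn ρ (by simp [hρ])), upd_ne hne]
      · have hne : n' ≠ τ.node := fun e => hn τ (by simp) e.symm
        rw [← c hd n' ha (fun ρ hρ => hn ρ (by simp [hρ])), upd_ne hne]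

theorem ok_of_cond {l : List (Cmd N C)} (hl : Good l) :
    ∀ f : Node N → Val C, ValidFS f → Cond l f → SeqOK l f := by
  induction l with
  | nil => intro f _ _; trivial
  | cons σ l ih =>
    intro f hf hc
    obtain ⟨hnull, hp⟩ := hl
    rw [List.pairwise_cons] at hp
    obtain ⟨a, b, c⟩ := hc σ (by simp)
    have hns := hnull σ (by simp)
    have hv : ValidFS (upd f σ) := by
      constructor
      · apply (hf.1.insert σ.node).subset
        intro n hn
        by_cases e : n = σ.node
        · exact Or.inl e
        · right
          simpa [upd_ne e] using hn
      · intro n m ha hn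
        by_cases e : n = σ.node
        · subst e
          rw [upd_ne ha.2]
          rw [upd_self] at hn
          by_cases hi : σ.inp = Val.empty
          · by_cases hm : ∀ ρ ∈ σ :: l, ρ.node ≠ m
            · exact c (by rw [hi]; exact lt_of_empty hn) m ha hm
            · push Not at hm
              obtain ⟨ρ, hρ, rfl⟩ := hm
              rcases List.mem_cons.1 hρ with rfl | hρ
              · exact absurd rfl ha.2
              · rcases (hp.1 ρ hρ).2 (Or.inr ha.1) with h | h
                · exact absurd h.2.1 hn
                · exact (anc_asymm h.1 ha).elim
          · exact hf.2 _ _ ha (by rwa [a])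
        · rw [upd_ne e] at hn
          by_cases e' : m = σ.node
          · subst e'
            rw [upd_self]
            by_contra ho
            have hd := hf.2 _ _ ha hn
            rw [a] at hd
            by_cases hm : ∀ ρ ∈ σ :: l, ρ.node ≠ n
            · exact hn (b (by rw [hd]; exact lt_of_dir ho) n ha hm)
            · push Not at hm
              obtain ⟨ρ, hρ, rfl⟩ := hm
              rcases List.mem_cons.1 hρ with rfl | hρ
              · exact absurd rfl ha.2
              · rcases (hp.1 ρ hρ).2 (Or.inl ha.1) with h | h
                · exact anc_asymm h.1 ha
                · exact ho h.2.1
          · rw [upd_ne e']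
            exact hf.2 _ _ ha hn
    refine ⟨a, hv, ih ⟨fun τ h => hnull τ (by simp [h]), hp.2⟩ _ hv ?_⟩
    intro τ hτ
    obtain ⟨a', b', c'⟩ := hc τ (by simp [hτ])
    obtain ⟨q1, q2⟩ := hp.1 τ hτ
    refine ⟨by rw [upd_ne q1.symm, a'], fun hd n' ha hn => ?_, fun hd n' ha hn => ?_⟩
    · by_cases e : n' = σ.node
      · subst e
        rw [upd_self]
        rcases q2 (Or.inr ha.1) with h | h
        · exact h.2.1
        · exact (anc_asymm h.1 ha).elim
      · rw [upd_ne e]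
        refine b' hd n' ha fun ρ hρ => ?_
        rcases List.mem_cons.1 hρ with rfl | hρ
        · exact fun h => e h.symm
        · exact hn ρ hρ
    · by_cases e : n' = σ.node
      · subst e
        rw [upd_self]
        rcases q2 (Or.inl ha.1) with h | h
        · exact (anc_asymm h.1 ha).elim
        · exact h.2.1
      · rw [upd_ne e]
        refine c' hd n' ha fun ρ hρ => ?_
        rcases List.mem_cons.1 hρ with rfl | hρ
        · exact fun h => e h.symm
        · exact hn ρ hρ

/-- A rank that increases along `≪`. -/
def rk (σ : Cmd N C) : ℤ :=
  if vtype σ.out < vtype σ.inp then -(σ.node.1.length : ℤ) else σ.node.1.length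

theorem rk_lt {N C : Type} {σ τ : Cmd N C} (h : LL σ τ) : rk σ < rk τ := by
  rcases ll_ud h with ⟨a, b, c, d, e⟩ | ⟨a, b, c, d, e⟩
  · have := anc_len a
    have h1 : vtype σ.out < vtype σ.inp := by rw [b]; exact lt_of_empty c
    have h2 : vtype τ.out < vtype τ.inp := by rw [d]; exact lt_of_dir e
    simp only [rk, h1, h2, if_true]
    omega
  · have := anc_len a
    have h1 : vtype σ.inp < vtype σ.out := by rw [b]; exact lt_of_dir c
    have h2 : vtype τ.inp < vtype τ.out := by rw [d]; exact lt_of_empty e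
    simp only [rk, not_lt.2 h1.le, not_lt.2 h2.le, if_false]
    omega

theorem sub_of_sorted {N C : Type} {l : List (Cmd N C)} (h : l.Pairwise (fun a b => rk a ≤ rk b))
    {σ τ : Cmd N C} (hσ : σ ∈ l) (hτ : τ ∈ l) (hlt : rk σ < rk τ) :
    List.Sublist [σ, τ] l := by
  induction l with
  | nil => simp at hσ
  | cons c l ih =>
    rw [List.pairwise_cons] at h
    rcases List.mem_cons.1 hσ with rfl | hs <;> rcases List.mem_cons.1 hτ with rfl | ht
    · omega
    · exact List.Sublist.cons_cons _ (List.singleton_sublist.2 ht)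
    · have := h.1 σ hs
      omega
    · exact List.Sublist.cons _ (ih h.2 hs ht)

theorem exists_orders {N C : Type} {A : Set (Cmd N C)} (hA : A.Finite) : ∃ l, Orders A l := by
  classical
  let r : Cmd N C → Cmd N C → Prop := fun a b => rk a ≤ rk b
  have : Std.Total r := ⟨fun a b => le_total _ _⟩
  have : IsTrans (Cmd N C) r := ⟨fun a b c => le_trans⟩
  have hperm := List.perm_insertionSort r hA.toFinset.toList
  refine ⟨hA.toFinset.toList.insertionSort r, ?_, ?_, ?_⟩
  · exact hperm.nodup_iff.2 (Finset.nodup_toList _)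
  · intro σ
    rw [hperm.mem_iff]
    simp
  · intro σ hσ τ hτ h
    exact sub_of_sorted (List.pairwise_insertionSort r _) hσ hτ (rk_lt h)

/-- A canonical set `A` does not break `FS` iff for each `σ = ⟨n,x,y⟩ ∈ A`:
(a) `FS n = x`; (b) if `σ` is a destructor, `FS` is empty strictly below `n` at nodes not
mentioned in `A`; (c) if `σ` is a constructor, `FS` is a directory strictly above `n` at
nodes not mentioned in `A`. -/
theorem stmt_5 {N C : Type} [DecidableEq N] (A : Set (Cmd N C)) (hA : Canonical A)
    (f : Node N → Val C) (hf : ValidFS f) :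
    SetNoBreak A f ↔
      ∀ σ ∈ A,
        f σ.node = σ.inp ∧
        (vtype σ.out < vtype σ.inp →
          ∀ n' : Node N, Anc σ.node n' → ¬ Mentions A n' → f n' = Val.empty) ∧
        (vtype σ.inp < vtype σ.out →
          ∀ n' : Node N, Anc n' σ.node → ¬ Mentions A n' → f n' = Val.dir) := by
  have key : ∀ l, Orders A l → (Cond l f ↔ ∀ σ ∈ A,
        f σ.node = σ.inp ∧
        (vtype σ.out < vtype σ.inp →
          ∀ n' : Node N, Anc σ.node n' → ¬ Mentions A n' → f n' = Val.empty) ∧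
        (vtype σ.inp < vtype σ.out →
          ∀ n' : Node N, Anc n' σ.node → ¬ Mentions A n' → f n' = Val.dir)) := by
    intro l ho
    simp only [Cond, Mentions, ho.2.1, not_exists, not_and, ne_eq]
  constructor
  · rintro ⟨⟨l, ho⟩, h⟩
    exact (key l ho).1 (cond_of_ok ((good_of_orders hA ho).2.imp fun h => h.1) f (h l ho))
  · intro h
    exact ⟨exists_orders hA.1, fun l ho =>
      ok_of_cond (good_of_orders hA ho) f hf ((key l ho).2 h)⟩

end FileSync
end
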